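/- arXiv:1207.0389 — 3 statements merged into one kernel-verified Lean document; each statement's English description precedes it below -/
import Mathlib

section
/- Let m ≥ 1, r ≥ 0 and d be integers with m + r ≤ d, and let a_1, …, a_m, c_1, …, c_r be m + r pairwise distinct nonzero real numbers. Assume Z_d(c_1,…,c_r) ≠ 0 and Z_{d+1−j}(c_1,…,c_r) ≠ 0 for 1 ≤ j ≤ m. Then Z_d(a_1, …, a_m, c_1, …, c_r) / Z_d(c_1, …, c_r) = [∏_{1≤j<k≤m} (a_j − a_k)]^{−1} · det[ a_k^{m−j} · Z_{d+1−j}(a_k, c_1, …, c_r) / Z_{d+1−j}(c_1, …, c_r) ]_{j,k=1}^{m}. (This is the Fay-like identity for the discrete KP τ-vector of partition functions, evaluated at the point t = [c_1] + ⋯ + [c_r] of miwa parameters.) -/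
open MeasureTheory
open scoped BigOperators

/-- The Vandermonde product `Δ(λ) = ∏_{i<j} (λ_j − λ_i)`. -/
def vandermondeProd {d : ℕ} (l : Fin d → ℝ) : ℝ :=
  ∏ p ∈ Finset.univ.filter (fun p : Fin d × Fin d => p.1 < p.2), (l p.2 - l p.1)

/-- The pairs `(j,k)` with `0 ≤ j < k < m`. -/
def pairsBelow (m : ℕ) : Finset (ℕ × ℕ) :=
  (Finset.range m ×ˢ Finset.range m).filter (fun p => p.1 < p.2)

/-- The normalized partition function `Z_d(a_0,…,a_{m−1})` of the Hermitian matrix model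
with external source eigenvalues `(a_0,…,a_{m−1},0,…,0)` and weight `W`. -/
noncomputable def Zpart (W : ℝ → ℝ) (d m : ℕ) (a : ℕ → ℝ) : ℝ :=
  ((∏ i ∈ Finset.range (d - m), (Nat.factorial i : ℝ)) *
      (∏ p ∈ pairsBelow m, (a p.2 - a p.1)) *
      ∏ k ∈ Finset.range m, a k ^ (d - m))⁻¹ *
    ∫ l : Fin d → ℝ,
      (Matrix.of fun i k : Fin d =>
          if (i : ℕ) < d - m then l k ^ (i : ℕ)
          else Real.exp (a ((i : ℕ) - (d - m)) * l k)).det *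
        vandermondeProd l * ∏ i : Fin d, W (l i)

/-- Concatenation of parameter lists: the first `m` entries from `a`, the rest from `c`. -/
def catParams (m : ℕ) (a c : ℕ → ℝ) : ℕ → ℝ :=
  fun i => if i < m then a i else c (i - m)

/-- Andréief's identity. -/
theorem integral_det_mul_det_eq_factorial_mul_det {d : ℕ} (W : ℝ → ℝ) (f g : Fin d → ℝ → ℝ)
    (hfg : ∀ i j, Integrable (fun x => f i x * g j x * W x)) :
    ∫ l : Fin d → ℝ, (Matrix.of fun i k : Fin d => f i (l k)).det *
        (Matrix.of fun i k : Fin d => g i (l k)).det * ∏ i, W (l i) =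
      (d.factorial : ℝ) * (Matrix.of fun i j : Fin d => ∫ x, f i x * g j x * W x).det := by
  have hexpand : ∀ l : Fin d → ℝ, (Matrix.of fun i k : Fin d => f i (l k)).det *
        (Matrix.of fun i k : Fin d => g i (l k)).det * ∏ i, W (l i) =
      ∑ τ : Equiv.Perm (Fin d), ∑ σ : Equiv.Perm (Fin d),
        ((Equiv.Perm.sign τ : ℤ) : ℝ) * ((Equiv.Perm.sign σ : ℤ) : ℝ) *
          ∏ k, (f (σ k) (l k) * g (τ k) (l k) * W (l k)) := by
    intro l
    rw [Matrix.det_apply', Matrix.det_apply', Finset.sum_mul_sum, Finset.sum_comm,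
      Finset.sum_mul]
    refine Finset.sum_congr rfl fun τ _ => ?_
    rw [Finset.sum_mul]
    refine Finset.sum_congr rfl fun σ _ => ?_
    simp only [Matrix.of_apply, Finset.prod_mul_distrib]
    ring
  have hint : ∀ τ σ : Equiv.Perm (Fin d), Integrable (fun l : Fin d → ℝ =>
      ((Equiv.Perm.sign τ : ℤ) : ℝ) * ((Equiv.Perm.sign σ : ℤ) : ℝ) *
        ∏ k, (f (σ k) (l k) * g (τ k) (l k) * W (l k))) := fun τ σ =>
    (Integrable.fintype_prod (μ := fun _ : Fin d => (volume : Measure ℝ))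
      (f := fun k x => f (σ k) x * g (τ k) x * W x) fun k => hfg _ _).const_mul _
  simp_rw [hexpand]
  rw [integral_finsetSum _ fun τ _ => integrable_finsetSum _ fun σ _ => hint τ σ]
  have hτ : ∀ τ : Equiv.Perm (Fin d), (∫ l : Fin d → ℝ, ∑ σ : Equiv.Perm (Fin d),
        ((Equiv.Perm.sign τ : ℤ) : ℝ) * ((Equiv.Perm.sign σ : ℤ) : ℝ) *
          ∏ k, (f (σ k) (l k) * g (τ k) (l k) * W (l k))) =
      (Matrix.of fun i j : Fin d => ∫ x, f i x * g j x * W x).det := by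
    intro τ
    rw [integral_finsetSum _ fun σ _ => hint τ σ]
    have hperm := Matrix.det_permute' τ (Matrix.of fun i j : Fin d => ∫ x, f i x * g j x * W x)
    have hsq : ((Equiv.Perm.sign τ : ℤ) : ℝ) * ((Equiv.Perm.sign τ : ℤ) : ℝ) = 1 := by
      rcases Int.units_eq_one_or (Equiv.Perm.sign τ) with h | h <;> simp [h]
    calc _ = ((Equiv.Perm.sign τ : ℤ) : ℝ) *
          ((Matrix.of fun i j : Fin d => ∫ x, f i x * g j x * W x).submatrix id τ).det := by
          rw [Matrix.det_apply', Finset.mul_sum]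
          refine Finset.sum_congr rfl fun σ _ => ?_
          rw [integral_const_mul,
            integral_fintype_prod_volume_eq_prod fun k x => f (σ k) x * g (τ k) x * W x]
          simp [mul_assoc]
      _ = _ := by rw [hperm, ← mul_assoc, hsq, one_mul]
  simp_rw [hτ]
  simp [Fintype.card_perm]

/-- Expressing the rows of `P` in those of `R`, where both agree off the range of `h`. -/
theorem det_mul_det_of_rows_eq {K D κ : Type*} [Field K] [Fintype D] [DecidableEq D]
    [Fintype κ] [DecidableEq κ] (P R : Matrix D D K) (h : κ → D) (hh : Function.Injective h)
    (ξ : κ → (D → K) →ₗ[K] K) (hPR : ∀ i ∉ Set.range h, P i = R i)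
    (hξ : ∀ i ∉ Set.range h, ∀ j, ξ j (R i) = 0) (hR : R.det ≠ 0) :
    P.det * (Matrix.of fun j k => ξ j (R (h k))).det =
      R.det * (Matrix.of fun j k => ξ j (P (h k))).det := by
  classical
  have hu : IsUnit R.det := isUnit_iff_ne_zero.mpr hR
  set A : Matrix D D K := P * R⁻¹ with hA
  have hAR : A * R = P := Matrix.nonsing_inv_mul_cancel_right R P hu
  have hrow : ∀ i, P i = ∑ l, A i l • R l := by
    intro i
    ext j
    rw [← hAR, Matrix.mul_apply, Finset.sum_apply]
    rfl
  have hAoff : ∀ i ∉ Set.range h, ∀ j, A i j = (1 : Matrix D D K) i j := by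
    intro i hi j
    have h1 : A i j = ∑ l, P i l * R⁻¹ l j := by rw [hA, Matrix.mul_apply]
    rw [h1, hPR i hi, ← Matrix.mul_nonsing_inv R hu, Matrix.mul_apply]
  have hsum : ∀ F : D → K, (∀ i ∉ Set.range h, F i = 0) → ∑ i, F i = ∑ k, F (h k) := by
    intro F hF
    rw [← Finset.sum_image (s := Finset.univ) (f := F) (g := h) fun x _ y _ e => hh e]
    refine (Finset.sum_subset (Finset.subset_univ _) fun x _ hx => hF x ?_).symm
    simpa using hx
  have hdetA : A.det = (A.submatrix h h).det := by
    rw [Matrix.twoBlockTriangular_det A (· ∈ Set.range h)]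
    · have h1 : A.toSquareBlockProp (fun i => ¬ i ∈ Set.range h) = 1 := by
        ext i j
        rw [Matrix.toSquareBlockProp_def, Matrix.of_apply, hAoff _ i.2]
        simp [Matrix.one_apply, Subtype.ext_iff]
      rw [h1, Matrix.det_one, mul_one]
      convert (Matrix.det_submatrix_equiv_self (Equiv.ofInjective h hh)
        (A.toSquareBlockProp (· ∈ Set.range h))).symm using 1
      · congr!
      · rfl
    · intro i hi j hj
      rw [hAoff i hi, Matrix.one_apply_ne]
      rintro rfl
      exact hi hj
  have hP : (Matrix.of fun j k => ξ j (P (h k))) =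
      (Matrix.of fun j k => ξ j (R (h k))) * (A.submatrix h h).transpose := by
    ext j k
    rw [Matrix.mul_apply, Matrix.of_apply, hrow (h k), map_sum,
      hsum _ fun i hi => by rw [map_smul, hξ i hi, smul_zero]]
    simp [mul_comm]
  rw [hP, Matrix.det_mul, Matrix.det_transpose, ← hdetA, ← hAR, Matrix.det_mul]
  ring

theorem prod_pairsBelow (m : ℕ) (g : ℕ × ℕ → ℝ) :
    ∏ p ∈ pairsBelow m, g p = ∏ k ∈ Finset.range m, ∏ j ∈ Finset.range k, g (j, k) := by
  rw [pairsBelow, Finset.prod_filter, Finset.prod_product_right]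
  refine Finset.prod_congr rfl fun k hk => ?_
  rw [← Finset.prod_filter]
  refine Finset.prod_congr ?_ fun _ _ => rfl
  ext j
  simp only [Finset.mem_range, Finset.mem_filter] at *
  omega

theorem sign_revPerm_eq_prod_pairsBelow (m : ℕ) :
    ((Equiv.Perm.sign (Fin.revPerm : Equiv.Perm (Fin m)) : ℤ) : ℝ) =
      ∏ _p ∈ pairsBelow m, (-1 : ℝ) := by
  rw [pairsBelow, Finset.prod_filter, Finset.prod_product, Finset.prod_range,
    Equiv.Perm.sign_eq_prod_prod_Ioi]
  push_cast
  refine Finset.prod_congr rfl fun i _ => ?_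
  rw [Finset.prod_range, ← Finset.prod_filter]
  refine Finset.prod_congr ?_ fun j hj => ?_
  · ext j
    simp
  · have : (i : Fin m) < j := by simpa using hj
    simp [this.not_gt]

theorem det_antitriangular {m : ℕ} (M : Matrix (Fin m) (Fin m) ℝ)
    (hM : ∀ j k : Fin m, (k : ℕ) + j + 1 < m → M j k = 0) :
    (∏ _p ∈ pairsBelow m, (-1 : ℝ)) * M.det = ∏ j : Fin m, M j j.rev := by
  rw [← sign_revPerm_eq_prod_pairsBelow, ← Matrix.det_permute, Matrix.det_of_isUpperTriangular]
  · rw [← Equiv.prod_comp Fin.revPerm fun j : Fin m => M j j.rev]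
    simp
  · intro j k hjk
    refine hM _ _ ?_
    have h1 : (k : ℕ) < j := hjk
    have h2 := j.isLt
    simp only [Fin.revPerm_apply, Fin.val_rev, id_eq]
    omega

theorem vandermondeProd_eq_det {d : ℕ} (l : Fin d → ℝ) :
    vandermondeProd l = (Matrix.of fun i k : Fin d => l k ^ (i : ℕ)).det := by
  have : (Matrix.of fun i k : Fin d => l k ^ (i : ℕ)) = (Matrix.vandermonde l).transpose := rfl
  rw [this, Matrix.det_transpose, Matrix.det_vandermonde, vandermondeProd, Finset.prod_filter,
    ← Finset.univ_product_univ, Finset.prod_product]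
  refine Finset.prod_congr rfl fun i _ => ?_
  rw [← Finset.prod_filter]
  refine Finset.prod_congr ?_ fun _ _ => rfl
  ext j
  simp

/-- The row functions of the external source matrix: `n` monomials, then exponentials. -/
noncomputable def sourceFun (n : ℕ) (a : ℕ → ℝ) (i : ℕ) (x : ℝ) : ℝ :=
  if i < n then x ^ i else Real.exp (a (i - n) * x)

/-- The matrix of moments of the first `d` functions of `sourceFun n a`. -/
noncomputable def momentMatrix (W : ℝ → ℝ) (d n : ℕ) (a : ℕ → ℝ) : Matrix (Fin d) (Fin d) ℝ :=
  Matrix.of fun i j => ∫ x, sourceFun n a i x * x ^ (j : ℕ) * W x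

/-- The normalization constant of the partition function. -/
noncomputable def Zconst (d m : ℕ) (a : ℕ → ℝ) : ℝ :=
  (∏ i ∈ Finset.range (d - m), (Nat.factorial i : ℝ)) *
    (∏ p ∈ pairsBelow m, (a p.2 - a p.1)) * ∏ k ∈ Finset.range m, a k ^ (d - m)

theorem integrable_sourceFun_mul_pow_mul {W : ℝ → ℝ} (hW : Measurable W) (hW0 : ∀ x, 0 ≤ W x)
    (hWint : ∀ (n : ℕ) (b : ℝ), Integrable (fun x => |x| ^ n * Real.exp (b * x) * W x))
    (n : ℕ) (a : ℕ → ℝ) (i j : ℕ) :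
    Integrable (fun x => sourceFun n a i x * x ^ j * W x) := by
  have key : ∀ (n : ℕ) (b : ℝ), Integrable (fun x => x ^ n * Real.exp (b * x) * W x) := by
    intro n b
    refine (hWint n b).mono' (by fun_prop) (Filter.Eventually.of_forall fun x => ?_)
    simp [abs_of_nonneg (hW0 x)]
  unfold sourceFun
  split_ifs
  · simpa [pow_add] using key (i + j) 0
  · simpa [mul_comm (Real.exp _)] using key j _

theorem Zpart_eq {W : ℝ → ℝ} (hW : Measurable W) (hW0 : ∀ x, 0 ≤ W x)
    (hWint : ∀ (n : ℕ) (b : ℝ), Integrable (fun x => |x| ^ n * Real.exp (b * x) * W x))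
    (d m : ℕ) (a : ℕ → ℝ) :
    Zpart W d m a =
      (Zconst d m a)⁻¹ * ((d.factorial : ℝ) * (momentMatrix W d (d - m) a).det) := by
  rw [momentMatrix, ← integral_det_mul_det_eq_factorial_mul_det W
    (fun i => sourceFun (d - m) a i) (fun j x => x ^ (j : ℕ))
    fun i j => integrable_sourceFun_mul_pow_mul hW hW0 hWint _ _ _ _]
  simp_rw [← vandermondeProd_eq_det]
  rfl

theorem momentMatrix_det_fay (W : ℝ → ℝ) (m r d : ℕ) (hmrd : m + r ≤ d) (a c : ℕ → ℝ)
    (hT : (momentMatrix W d (d - r) c).det ≠ 0) :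
    (momentMatrix W d (d - (m + r)) (catParams m a c)).det *
        ∏ j : Fin m, (momentMatrix W (d - (j : ℕ)) (d - j - r) c).det =
      (momentMatrix W d (d - r) c).det * ((∏ _p ∈ pairsBelow m, (-1 : ℝ)) *
        (Matrix.of fun j k : Fin m => (momentMatrix W (d - (j : ℕ)) (d - j - (1 + r))
          (catParams 1 (fun _ => a (k : ℕ)) c)).det).det) := by
  have hlt : ∀ j : Fin m, d - j - r - 1 < d - (j : ℕ) := fun j => by have := j.isLt; omega
  let ξ : Fin m → (Fin d → ℝ) →ₗ[ℝ] ℝ := fun j =>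
    (LinearMap.proj ⟨d - j - r - 1, hlt j⟩).comp
      ((Matrix.cramer (momentMatrix W (d - (j : ℕ)) (d - j - r) c).transpose).comp
        (LinearMap.funLeft ℝ ℝ (Fin.castLE (Nat.sub_le d j))))
  have hξ : ∀ j v, ξ j v = ((momentMatrix W (d - (j : ℕ)) (d - j - r) c).updateRow
      ⟨d - j - r - 1, hlt j⟩ (v ∘ Fin.castLE (Nat.sub_le d j))).det := fun j v =>
    Matrix.cramer_transpose_apply _ _ _
  have hrow : ∀ (j : Fin m) (i : Fin d) (i' : Fin (d - (j : ℕ))),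
      sourceFun (d - r) c i = sourceFun (d - j - r) c i' →
      momentMatrix W d (d - r) c i ∘ Fin.castLE (Nat.sub_le d j) =
        momentMatrix W (d - (j : ℕ)) (d - j - r) c i' := by
    intro j i i' h
    ext l
    simp [momentMatrix, h]
  have hlow : ∀ (j : Fin m) (i : Fin d), (i : ℕ) < d - j - r - 1 →
      ξ j (momentMatrix W d (d - r) c i) = 0 := by
    intro j i hi
    rw [hξ, hrow j i ⟨i, hi.trans (hlt j)⟩, Matrix.det_updateRow_eq_zero]
    · simp only [ne_eq, Fin.mk.injEq]
      omega
    · ext x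
      simp only [sourceFun]
      rw [if_pos (by omega), if_pos (by omega)]
  let h : Fin m → Fin d := fun k => ⟨d - (m + r) + k, by have := k.isLt; omega⟩
  have hrange : ∀ i : Fin d, i ∉ Set.range h → (i : ℕ) < d - (m + r) ∨ d - r ≤ i := by
    intro i hi
    by_contra! hcon
    exact hi ⟨⟨i - (d - (m + r)), by omega⟩, Fin.ext (by simp only [h]; omega)⟩
  have main := det_mul_det_of_rows_eq (momentMatrix W d (d - (m + r)) (catParams m a c))
    (momentMatrix W d (d - r) c) h
    (fun x y hxy => by
      have := congrArg Fin.val hxy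
      simp only [h] at this
      exact Fin.ext (by omega)) ξ ?_ ?_ hT
  · have hanti := det_antitriangular
      (Matrix.of fun j k => ξ j (momentMatrix W d (d - r) c (h k))) fun j k hjk =>
        hlow j (h k) (by simp only [h]; omega)
    have hdiag : ∀ j : Fin m, ξ j (momentMatrix W d (d - r) c (h j.rev)) =
        (momentMatrix W (d - (j : ℕ)) (d - j - r) c).det := by
      intro j
      have hj := j.isLt
      rw [hξ, hrow j _ ⟨d - j - r - 1, hlt j⟩, Matrix.updateRow_eq_self]
      ext x
      simp only [sourceFun, h, Fin.val_rev]
      rw [if_pos (by omega), if_pos (by omega)]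
      congr 1
      omega
    have hU : ∀ j k : Fin m, ξ j (momentMatrix W d (d - (m + r)) (catParams m a c) (h k)) =
        (momentMatrix W (d - (j : ℕ)) (d - j - (1 + r))
          (catParams 1 (fun _ => a (k : ℕ)) c)).det := by
      intro j k
      have hj := j.isLt
      rw [hξ]
      congr 1
      ext i l
      rw [Matrix.updateRow_apply]
      split_ifs with hi
      · subst hi
        have e : sourceFun (d - (m + r)) (catParams m a c) (h k) =
            sourceFun (d - j - (1 + r)) (catParams 1 (fun _ => a (k : ℕ)) c)
              (d - j - r - 1) := by
          ext x
          simp only [sourceFun, h, catParams]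
          rw [if_neg (by omega), if_pos (by omega), if_neg (by omega), if_pos (by omega)]
          congr 3
          omega
        simp [momentMatrix, e]
      · have hi' : (i : ℕ) ≠ d - j - r - 1 := fun e => hi (Fin.ext e)
        have e : sourceFun (d - j - r) c i =
            sourceFun (d - j - (1 + r)) (catParams 1 (fun _ => a (k : ℕ)) c) i := by
          ext x
          simp only [sourceFun, catParams]
          split_ifs <;> first | omega | rfl | skip
          congr 3
          omega
        simp [momentMatrix, e]
    simp only [Matrix.of_apply, hdiag] at hanti
    simp only [hU] at main
    rw [← hanti, ← mul_left_comm, main]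
    ring
  · intro i hi
    have e : sourceFun (d - (m + r)) (catParams m a c) i = sourceFun (d - r) c i := by
      ext x
      simp only [sourceFun, catParams]
      rcases hrange i hi with hi | hi
      · rw [if_pos (by omega), if_pos (by omega)]
      · rw [if_neg (by omega), if_neg (by omega), if_neg (by omega)]
        congr 3
        omega
    ext l
    simp [momentMatrix, e]
  · intro i hi j
    have hj := j.isLt
    rcases hrange i hi with hi | hi
    · exact hlow j i (by omega)
    · rw [hξ, hrow j i ⟨i - j, by omega⟩, Matrix.det_updateRow_eq_zero]
      · simp only [ne_eq, Fin.mk.injEq]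
        omega
      · ext x
        simp only [sourceFun]
        rw [if_neg (by omega), if_neg (by omega)]
        congr 3
        omega

theorem prod_pairsBelow_catParams (m r : ℕ) (a c : ℕ → ℝ) :
    ∏ p ∈ pairsBelow (m + r), (catParams m a c p.2 - catParams m a c p.1) =
      (∏ p ∈ pairsBelow m, (a p.2 - a p.1)) *
        (∏ k ∈ Finset.range m, ∏ i ∈ Finset.range r, (c i - a k)) *
        ∏ p ∈ pairsBelow r, (c p.2 - c p.1) := by
  simp only [prod_pairsBelow]
  rw [Finset.prod_range_add, Finset.prod_comm (s := Finset.range m) (t := Finset.range r),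
    mul_assoc, ← Finset.prod_mul_distrib]
  congr 1
  · refine Finset.prod_congr rfl fun k hk => Finset.prod_congr rfl fun j hj => ?_
    rw [Finset.mem_range] at hk hj
    simp [catParams, hk, hj.trans hk]
  · refine Finset.prod_congr rfl fun k _ => ?_
    rw [Finset.prod_range_add]
    congr 1
    · refine Finset.prod_congr rfl fun j hj => ?_
      rw [Finset.mem_range] at hj
      simp [catParams, hj]
    · simp [catParams]

theorem Zconst_div_Zconst_catParams {m r d : ℕ} (hmrd : m + r ≤ d) (a c : ℕ → ℝ)
    (hc : ∀ i < r, c i ≠ 0) (hV : ∏ p ∈ pairsBelow r, (c p.2 - c p.1) ≠ 0) :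
    Zconst d r c / Zconst d (m + r) (catParams m a c) =
      (∏ j ∈ Finset.range m, ((d - (m + r) + j).factorial : ℝ)) *
        (∏ p ∈ pairsBelow m, (a p.2 - a p.1))⁻¹ *
        ∏ k ∈ Finset.range m, ((∏ i ∈ Finset.range r, c i) /
          (a k ^ (d - (m + r)) * ∏ i ∈ Finset.range r, (c i - a k))) := by
  have hd : d - r = d - (m + r) + m := by omega
  unfold Zconst
  rw [prod_pairsBelow_catParams, hd]
  generalize d - (m + r) = p
  have hcat : ∏ k ∈ Finset.range (m + r), catParams m a c k ^ p =
      (∏ k ∈ Finset.range m, a k ^ p) * ∏ i ∈ Finset.range r, c i ^ p := by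
    rw [Finset.prod_range_add]
    congr 1
    · refine Finset.prod_congr rfl fun j hj => ?_
      rw [Finset.mem_range] at hj
      simp [catParams, hj]
    · simp [catParams]
  have hF : ∏ i ∈ Finset.range p, (i.factorial : ℝ) ≠ 0 :=
    Finset.prod_ne_zero_iff.mpr fun i _ => by positivity
  have hcp : ∏ i ∈ Finset.range r, c i ^ p ≠ 0 :=
    Finset.prod_ne_zero_iff.mpr fun i hi => pow_ne_zero _ (hc i (Finset.mem_range.mp hi))
  rw [hcat, Finset.prod_range_add, Finset.prod_div_distrib, Finset.prod_mul_distrib,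
    Finset.prod_const, Finset.card_range]
  simp_rw [pow_add, Finset.prod_mul_distrib, Finset.prod_pow _ m]
  field_simp

/-- Fay-like identity for the discrete KP τ-vector of partition functions, evaluated at
the Miwa point `t = [c_1] + ⋯ + [c_r]`:
`Z_d(a_1,…,a_m,c_1,…,c_r)/Z_d(c_1,…,c_r)
  = [∏_{j<k}(a_j−a_k)]⁻¹ det[a_k^{m−j} Z_{d+1−j}(a_k,c_1,…,c_r)/Z_{d+1−j}(c_1,…,c_r)]`. -/
theorem Zpart_ratio_eq_det_rank_one_at_miwa_point
    (W : ℝ → ℝ) (hWmeas : Measurable W) (hWnonneg : ∀ x, 0 ≤ W x)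
    (hWsupp : (Function.support W).Infinite)
    (hWint : ∀ (n : ℕ) (b : ℝ), Integrable (fun x => |x| ^ n * Real.exp (b * x) * W x))
    (m r d : ℕ) (hm : 1 ≤ m) (hmrd : m + r ≤ d)
    (a c : ℕ → ℝ)
    (hne : ∀ i < m + r, catParams m a c i ≠ 0)
    (hdist : ∀ i < m + r, ∀ j < m + r, i ≠ j → catParams m a c i ≠ catParams m a c j)
    (hZc : Zpart W d r c ≠ 0)
    (hZcj : ∀ j < m, Zpart W (d - j) r c ≠ 0) :
    Zpart W d (m + r) (catParams m a c) / Zpart W d r c =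
      (∏ p ∈ pairsBelow m, (a p.1 - a p.2))⁻¹ *
        (Matrix.of fun j k : Fin m =>
            a (k : ℕ) ^ (m - 1 - (j : ℕ)) *
              (Zpart W (d - (j : ℕ)) (1 + r) (catParams 1 (fun _ => a (k : ℕ)) c) /
                Zpart W (d - (j : ℕ)) r c)).det := by
  have hc : ∀ i < r, c i ≠ 0 := fun i hi => by
    simpa [catParams] using hne (m + i) (by omega)
  have hVc : ∏ p ∈ pairsBelow r, (c p.2 - c p.1) ≠ 0 := by
    rw [Finset.prod_ne_zero_iff]
    rintro ⟨i, j⟩ hij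
    simp only [pairsBelow, Finset.mem_filter, Finset.mem_product, Finset.mem_range] at hij
    have := hdist (m + j) (by omega) (m + i) (by omega) (by omega)
    simp only [catParams, add_lt_iff_neg_left, not_lt_zero, if_false,
      Nat.add_sub_cancel_left] at this
    exact sub_ne_zero.mpr this
  have ha : ∀ k : Fin m, a k ≠ 0 := fun k => by
    simpa [catParams] using hne k (by omega)
  have hratio : ∀ d' m' (b : ℕ → ℝ), m' + r ≤ d' →
      Zpart W d' (m' + r) (catParams m' b c) / Zpart W d' r c =
        Zconst d' r c / Zconst d' (m' + r) (catParams m' b c) *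
          ((momentMatrix W d' (d' - (m' + r)) (catParams m' b c)).det /
            (momentMatrix W d' (d' - r) c).det) := by
    intro d' m' b _
    rw [Zpart_eq hWmeas hWnonneg hWint, Zpart_eq hWmeas hWnonneg hWint]
    have : (d'.factorial : ℝ) ≠ 0 := by positivity
    rw [mul_left_comm, mul_left_comm (Zconst d' r c)⁻¹, mul_div_mul_left _ _ this]
    simp only [div_eq_mul_inv, mul_inv, inv_inv]
    ring
  have hTne : ∀ j < m, (momentMatrix W (d - j) (d - j - r) c).det ≠ 0 := by
    intro j hj h0
    apply hZcj j hj
    rw [Zpart_eq hWmeas hWnonneg hWint, h0]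
    simp
  have hentry : (Matrix.of fun j k : Fin m =>
      a (k : ℕ) ^ (m - 1 - (j : ℕ)) *
        (Zpart W (d - (j : ℕ)) (1 + r) (catParams 1 (fun _ => a (k : ℕ)) c) /
          Zpart W (d - (j : ℕ)) r c)) =
      Matrix.of fun j k : Fin m =>
        (((d - (m + r) + (m - 1 - (j : ℕ))).factorial : ℝ) /
          (momentMatrix W (d - (j : ℕ)) (d - j - r) c).det) *
        (Matrix.of fun j k : Fin m => ((∏ i ∈ Finset.range r, c i) /
          (a k ^ (d - (m + r)) * ∏ i ∈ Finset.range r, (c i - a k))) *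
        (Matrix.of fun j k : Fin m => (momentMatrix W (d - (j : ℕ)) (d - j - (1 + r))
          (catParams 1 (fun _ => a (k : ℕ)) c)).det) j k) j k := by
    ext j k
    have hj := j.isLt
    have hak := pow_ne_zero (m - 1 - (j : ℕ)) (ha k)
    simp only [Matrix.of_apply]
    rw [hratio _ _ _ (by omega), Zconst_div_Zconst_catParams (by omega) _ _ hc hVc,
      show d - (j : ℕ) - (1 + r) = d - (m + r) + (m - 1 - j) by omega, prod_pairsBelow]
    simp only [Finset.prod_range_one, Finset.prod_range_zero, inv_one, mul_one, add_zero,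
      pow_add]
    rw [mul_comm (a (k : ℕ) ^ (d - (m + r))) (a k ^ _), mul_assoc (a (k : ℕ) ^ _),
      ← div_div _ (a (k : ℕ) ^ (m - 1 - (j : ℕ)))]
    field_simp
  have hfact : ∏ j : Fin m, ((d - (m + r) + (m - 1 - (j : ℕ))).factorial : ℝ) =
      ∏ j ∈ Finset.range m, ((d - (m + r) + j).factorial : ℝ) := by
    rw [← Finset.prod_range_reflect (fun j => ((d - (m + r) + j).factorial : ℝ)) m,
      Finset.prod_range]
  have hsign : ∏ p ∈ pairsBelow m, (a p.1 - a p.2) =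
      (∏ _p ∈ pairsBelow m, (-1 : ℝ)) * ∏ p ∈ pairsBelow m, (a p.2 - a p.1) := by
    rw [← Finset.prod_mul_distrib]
    exact Finset.prod_congr rfl fun p _ => by ring
  have hs : (∏ _p ∈ pairsBelow m, (-1 : ℝ))⁻¹ = ∏ _p ∈ pairsBelow m, (-1 : ℝ) := by
    rw [← Finset.prod_inv_distrib]
    norm_num
  have hT0 : (momentMatrix W d (d - r) c).det ≠ 0 := hTne 0 (by omega)
  have hprodT : ∏ j : Fin m, (momentMatrix W (d - (j : ℕ)) (d - j - r) c).det ≠ 0 :=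
    Finset.prod_ne_zero_iff.mpr fun j _ => hTne j j.isLt
  have hfay := momentMatrix_det_fay W m r d hmrd a c hT0
  rw [← eq_div_iff hprodT] at hfay
  rw [hentry, Matrix.det_mul_column, Matrix.det_mul_row, Finset.prod_div_distrib, hfact,
    hratio d m a hmrd, Zconst_div_Zconst_catParams hmrd a c hc hVc, hfay, hsign, mul_inv, hs,
    Finset.prod_range (fun k => (∏ i ∈ Finset.range r, c i) /
      (a k ^ (d - (m + r)) * ∏ i ∈ Finset.range r, (c i - a k)))]
  rw [mul_div_assoc, mul_div_cancel_left₀ _ hT0]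
  ring
end

section
/- Let r ≥ 0 and d ≥ r + 2 be integers, and let a, b, c_1, …, c_r be r + 2 pairwise distinct nonzero real numbers. Then the two-variable Fay-like identity holds: a · Z_d(a, c_1,…,c_r) · Z_{d−1}(b, c_1,…,c_r) − b · Z_d(b, c_1,…,c_r) · Z_{d−1}(a, c_1,…,c_r) = (a − b) · Z_d(a, b, c_1,…,c_r) · Z_{d−1}(c_1,…,c_r). -/
open MeasureTheory
open scoped BigOperators

/-- The parameter list `(x, c_0, c_1, …)`. -/
def consParam (x : ℝ) (c : ℕ → ℝ) : ℕ → ℝ :=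
  fun i => if i = 0 then x else c (i - 1)

/-- The parameter list `(x, y, c_0, c_1, …)`. -/
def consParam2 (x y : ℝ) (c : ℕ → ℝ) : ℕ → ℝ :=
  fun i => if i = 0 then x else if i = 1 then y else c (i - 2)


/-- The three-term Plücker relation for the minors obtained by varying two rows of a matrix. -/
lemma det_updateRow_plucker {ι R : Type*} [Fintype ι] [DecidableEq ι] [CommRing R]
    (M : Matrix ι ι R) {i j : ι} (hij : i ≠ j) (p a b e : ι → R) :
    ((M.updateRow i p).updateRow j a).det * ((M.updateRow i b).updateRow j e).det -
        ((M.updateRow i p).updateRow j b).det * ((M.updateRow i a).updateRow j e).det =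
      -(((M.updateRow i a).updateRow j b).det * ((M.updateRow i p).updateRow j e).det) := by
  set A := (M.updateRow i p).updateRow j a with hA
  let L : (ι → R) →ₗ[R] R := LinearMap.proj i ∘ₗ (M.updateRow j e).transpose.cramer
  have hL : ∀ u, L u = ((M.updateRow i u).updateRow j e).det := fun u => by
    simp only [L, LinearMap.comp_apply, LinearMap.proj_apply, Matrix.cramer_transpose_apply]
    rw [Matrix.updateRow_comm _ hij.symm]
  have hAi : A i = p := by ext; simp [hA, hij]
  have hAj : A j = a := by ext; simp [hA]
  have hAk : ∀ k, k ≠ i → k ≠ j → A k = M k := fun k hi hj => by ext; simp [hA, hi, hj]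
  have key := congrArg L (Matrix.mulVec_cramer A.transpose b)
  have hsum : A.transpose.mulVec (A.transpose.cramer b) =
      ∑ k, (A.updateRow k b).det • A k := by
    ext x
    simp [Matrix.mulVec, dotProduct, Matrix.cramer_transpose_apply, mul_comm]
  have hvanish : ∀ k, k ≠ i ∧ k ≠ j → (A.updateRow k b).det • L (A k) = 0 := by
    rintro k ⟨hi, hj⟩
    have hzero : ((M.updateRow i (M.row k)).updateRow j e).det = 0 :=
      Matrix.det_zero_of_row_eq hi.symm (by ext x; simp [hij, hi, hj])
    rw [hL, hAk k hi hj]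
    exact (congrArg _ hzero).trans (smul_zero _)
  rw [hsum, map_sum, map_smul, Matrix.det_transpose] at key
  simp only [map_smul] at key
  rw [Fintype.sum_eq_add i j hij hvanish, hAi, hAj, hL, hL, hL] at key
  have h1 : A.updateRow j b = (M.updateRow i p).updateRow j b := by
    simp [hA, Matrix.updateRow_idem]
  have h2 : (A.updateRow i b).det = -((M.updateRow i a).updateRow j b).det := by
    have h := Matrix.det_permute (Equiv.swap i j) ((M.updateRow i a).updateRow j b)
    rw [Equiv.Perm.sign_swap hij] at h
    simp only [Units.val_neg, Units.val_one, Int.cast_neg, Int.cast_one, neg_one_mul] at h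
    rw [← h]
    congr 1
    ext k x
    rcases eq_or_ne k i with rfl | hi
    · simp
    rcases eq_or_ne k j with rfl | hj
    · simp [hA, hij, hij.symm]
    · simp [hA, hi, hj, Equiv.swap_apply_of_ne_of_ne hi hj]
  rw [h1, h2] at key
  simp only [smul_eq_mul] at key
  linear_combination -key

lemma vandermondeProd_eq_det_s3 {d : ℕ} (l : Fin d → ℝ) :
    vandermondeProd l = (Matrix.vandermonde l).transpose.det := by
  rw [Matrix.det_transpose, Matrix.det_vandermonde, vandermondeProd, Finset.prod_filter,
    ← Finset.univ_product_univ, Finset.prod_product]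
  refine Finset.prod_congr rfl fun i _ => ?_
  rw [← Finset.prod_filter]
  exact Finset.prod_congr (by ext; simp) fun _ _ => rfl

/-- Andréief's identity. -/
lemma integral_det_mul_det_mul_prod {d : ℕ} (f g : Fin d → ℝ → ℝ) (W : ℝ → ℝ)
    (hint : ∀ i j, Integrable (fun x => f i x * g j x * W x)) :
    ∫ l : Fin d → ℝ, (Matrix.of fun i k => f i (l k)).det * (Matrix.of fun i k => g i (l k)).det *
        ∏ i, W (l i) =
      (d.factorial : ℝ) * (Matrix.of fun i j => ∫ x, f i x * g j x * W x).det := by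
  have hterm : ∀ σ τ : Equiv.Perm (Fin d), Integrable (fun l : Fin d → ℝ =>
      ((Equiv.Perm.sign σ : ℤ) : ℝ) * ((Equiv.Perm.sign τ : ℤ) : ℝ) *
        ∏ k, (f (σ k) (l k) * g (τ k) (l k) * W (l k))) := fun σ τ =>
    (Integrable.fintype_prod (f := fun k x => f (σ k) x * g (τ k) x * W x)
      fun k => hint (σ k) (τ k)).const_mul _
  have hexpand : ∀ l : Fin d → ℝ, (Matrix.of fun i k => f i (l k)).det *
      (Matrix.of fun i k => g i (l k)).det * ∏ i, W (l i) =
      ∑ τ : Equiv.Perm (Fin d), ∑ σ : Equiv.Perm (Fin d),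
      ((Equiv.Perm.sign σ : ℤ) : ℝ) * ((Equiv.Perm.sign τ : ℤ) : ℝ) *
        ∏ k, (f (σ k) (l k) * g (τ k) (l k) * W (l k)) := fun l => by
    rw [Matrix.det_apply', Matrix.det_apply', Finset.sum_mul_sum, Finset.sum_comm, Finset.sum_mul]
    refine Finset.sum_congr rfl fun τ _ => ?_
    rw [Finset.sum_mul]
    refine Finset.sum_congr rfl fun σ _ => ?_
    simp only [Finset.prod_mul_distrib, Matrix.of_apply]
    ring
  simp only [hexpand]
  rw [integral_finsetSum _ fun τ _ => integrable_finsetSum _ fun σ _ => hterm σ τ]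
  have hinner : ∀ τ : Equiv.Perm (Fin d), ∫ l : Fin d → ℝ, ∑ σ : Equiv.Perm (Fin d),
      ((Equiv.Perm.sign σ : ℤ) : ℝ) * ((Equiv.Perm.sign τ : ℤ) : ℝ) *
        ∏ k, (f (σ k) (l k) * g (τ k) (l k) * W (l k)) =
      (Matrix.of fun i j => ∫ x, f i x * g j x * W x).det := fun τ => by
    rw [integral_finsetSum _ fun σ _ => hterm σ τ]
    have hsq : ((Equiv.Perm.sign τ : ℤ) : ℝ) * ((Equiv.Perm.sign τ : ℤ) : ℝ) = 1 := by
      exact_mod_cast Int.units_coe_mul_self _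
    have hperm := Matrix.det_permute' τ (Matrix.of fun i j => ∫ x, f i x * g j x * W x)
    rw [← one_mul (Matrix.det _), ← hsq, mul_assoc, ← hperm, Matrix.det_apply', Finset.mul_sum]
    refine Finset.sum_congr rfl fun σ _ => ?_
    rw [integral_const_mul, integral_fintype_prod_volume_eq_prod
      (fun k x => f (σ k) x * g (τ k) x * W x)]
    simp only [Matrix.submatrix_apply, Matrix.of_apply, id_eq]
    ring
  simp only [hinner, Finset.sum_const, Finset.card_univ, Fintype.card_perm, Fintype.card_fin,
    nsmul_eq_mul]

lemma prod_range_consParam (m : ℕ) (x : ℝ) (c : ℕ → ℝ) (g : ℝ → ℝ) :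
    ∏ k ∈ Finset.range (1 + m), g (consParam x c k) = g x * ∏ k ∈ Finset.range m, g (c k) := by
  rw [add_comm 1 m, Finset.prod_range_succ', mul_comm]
  simp [consParam]

lemma prod_pairsBelow_consParam (m : ℕ) (x : ℝ) (c : ℕ → ℝ) :
    ∏ p ∈ pairsBelow (1 + m), (consParam x c p.2 - consParam x c p.1) =
      (∏ k ∈ Finset.range m, (c k - x)) * ∏ p ∈ pairsBelow m, (c p.2 - c p.1) := by
  simp only [pairsBelow, Finset.prod_filter, Finset.prod_product, add_comm 1 m,
    Finset.prod_range_succ']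
  simp [consParam, mul_comm]

lemma consParam2_eq_consParam (x y : ℝ) (c : ℕ → ℝ) :
    consParam2 x y c = consParam x (consParam y c) := by
  funext i
  rcases i with _ | _ | i <;> simp [consParam, consParam2]

/-- The `i`-th row of the moment matrix of `W`, with `N` rows of polynomial moments followed by
rows of exponential moments with exponents `a 0, a 1, …`. -/
noncomputable def momentRow (W : ℝ → ℝ) (N : ℕ) (a : ℕ → ℝ) (i j : ℕ) : ℝ :=
  ∫ x, (if i < N then x ^ i else Real.exp (a (i - N) * x)) * x ^ j * W x

lemma integrable_pow_mul_exp_mul {W : ℝ → ℝ} (hWmeas : Measurable W)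
    (hWint : ∀ (n : ℕ) (b : ℝ), Integrable (fun x => |x| ^ n * Real.exp (b * x) * W x))
    (n : ℕ) (b : ℝ) : Integrable (fun x => x ^ n * Real.exp (b * x) * W x) := by
  refine (hWint n b).mono (by fun_prop) (Filter.Eventually.of_forall fun x => ?_)
  simp

lemma Zpart_eq_det {W : ℝ → ℝ} (hWmeas : Measurable W)
    (hWint : ∀ (n : ℕ) (b : ℝ), Integrable (fun x => |x| ^ n * Real.exp (b * x) * W x))
    {d m N : ℕ} (hN : d - m = N) (a : ℕ → ℝ) :
    Zpart W d m a =
      ((∏ i ∈ Finset.range N, (Nat.factorial i : ℝ)) *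
        (∏ p ∈ pairsBelow m, (a p.2 - a p.1)) * ∏ k ∈ Finset.range m, a k ^ N)⁻¹ *
      ((d.factorial : ℝ) * (Matrix.of fun i j : Fin d => momentRow W N a i j).det) := by
  subst hN
  rw [Zpart]
  congr 1
  refine Eq.trans ?_ (integral_det_mul_det_mul_prod
    (fun (i : Fin d) x => if (i : ℕ) < d - m then x ^ (i : ℕ)
      else Real.exp (a ((i : ℕ) - (d - m)) * x)) (fun (j : Fin d) x => x ^ (j : ℕ)) W ?_)
  · simp only [vandermondeProd_eq_det_s3]
    rfl
  · intro i j
    split_ifs with h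
    · have := integrable_pow_mul_exp_mul hWmeas hWint (i + j : ℕ) 0
      simpa [pow_add] using this
    · have := integrable_pow_mul_exp_mul hWmeas hWint (j : ℕ) (a ((i : ℕ) - (d - m)))
      simpa only [mul_comm] using this

/-- Expansion of a determinant along a row supported in the last column. -/
lemma det_updateRow_single_last {R : Type*} [CommRing R] {n : ℕ}
    (M : Matrix (Fin (n + 1)) (Fin (n + 1)) R) (i : Fin (n + 1)) :
    (M.updateRow i (Pi.single (Fin.last n) 1)).det =
      (-1) ^ ((i : ℕ) + n) * (M.submatrix i.succAbove Fin.castSucc).det := by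
  rw [Matrix.det_succ_row _ i, Finset.sum_eq_single (Fin.last n)]
  · have : (M.updateRow i (Pi.single (Fin.last n) 1)).submatrix i.succAbove
        (Fin.last n).succAbove = M.submatrix i.succAbove Fin.castSucc := by
      ext x y
      simp
    rw [this]
    simp
  · intro j _ hj
    simp [hj]
  · simp

/-- The two-variable Fay-like identity:
`a Z_d(a,c⃗) Z_{d−1}(b,c⃗) − b Z_d(b,c⃗) Z_{d−1}(a,c⃗) = (a−b) Z_d(a,b,c⃗) Z_{d−1}(c⃗)`. -/
theorem Zpart_two_variable_fay
    (W : ℝ → ℝ) (hWmeas : Measurable W) (hWnonneg : ∀ x, 0 ≤ W x)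
    (hWsupp : (Function.support W).Infinite)
    (hWint : ∀ (n : ℕ) (b : ℝ), Integrable (fun x => |x| ^ n * Real.exp (b * x) * W x))
    (r d : ℕ) (hd : r + 2 ≤ d)
    (a b : ℝ) (c : ℕ → ℝ)
    (hne : ∀ i < r + 2, consParam2 a b c i ≠ 0)
    (hdist : ∀ i < r + 2, ∀ j < r + 2, i ≠ j → consParam2 a b c i ≠ consParam2 a b c j) :
    a * Zpart W d (1 + r) (consParam a c) * Zpart W (d - 1) (1 + r) (consParam b c) -
        b * Zpart W d (1 + r) (consParam b c) * Zpart W (d - 1) (1 + r) (consParam a c) =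
      (a - b) * Zpart W d (2 + r) (consParam2 a b c) * Zpart W (d - 1) r c := by
  have ha : a ≠ 0 := hne 0 (by omega)
  have hb : b ≠ 0 := hne 1 (by omega)
  have hab : b - a ≠ 0 := sub_ne_zero.2 (hdist 1 (by omega) 0 (by omega) one_ne_zero)
  obtain ⟨n, rfl⟩ : ∃ n, d = n + r + 1 + 1 := ⟨d - (r + 2), by omega⟩
  rw [Nat.add_sub_cancel]
  set M : Matrix (Fin (n + r + 1 + 1)) (Fin (n + r + 1 + 1)) ℝ :=
    Matrix.of fun i j => momentRow W n (consParam2 a b c) i j with hM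
  let i₀ : Fin (n + r + 1 + 1) := ⟨n, by omega⟩
  let i₁ : Fin (n + r + 1 + 1) := ⟨n + 1, by omega⟩
  have h01 : i₀ ≠ i₁ := by simp [i₀, i₁, Fin.ext_iff]
  let E : ℝ → Fin (n + r + 1 + 1) → ℝ := fun t j => ∫ x, Real.exp (t * x) * x ^ (j : ℕ) * W x
  let P : Fin (n + r + 1 + 1) → ℝ := fun j => ∫ x, x ^ n * x ^ (j : ℕ) * W x
  let e : Fin (n + r + 1 + 1) → ℝ := Pi.single (Fin.last _) 1
  have hrow_lt : ∀ (N N' : ℕ) (f g : ℕ → ℝ) (i j : ℕ), i < N → i < N' →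
      momentRow W N f i j = momentRow W N' g i j := fun N N' f g i j h h' => by
    simp only [momentRow, if_pos h, if_pos h']
  have hrow_ge : ∀ (N N' : ℕ) (f g : ℕ → ℝ) (i i' j : ℕ), N ≤ i → N' ≤ i' →
      f (i - N) = g (i' - N') → momentRow W N f i j = momentRow W N' g i' j :=
    fun N N' f g i i' j h h' hfg => by
      simp only [momentRow, if_neg h.not_gt, if_neg h'.not_gt, hfg]
  have hM_eq : ∀ i j, M i j = momentRow W n (consParam2 a b c) i j := fun _ _ => rfl
  have hrest : ∀ (u v : Fin (n + r + 1 + 1) → ℝ) (i j : Fin (n + r + 1 + 1)), i ≠ i₀ → i ≠ i₁ →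
      (M.updateRow i₀ u).updateRow i₁ v i j = M i j := fun u v i j h₀ h₁ => by
    simp [h₀, h₁]
  have hrow₀ : ∀ (u v : Fin (n + r + 1 + 1) → ℝ) (j : Fin (n + r + 1 + 1)),
      (M.updateRow i₀ u).updateRow i₁ v i₀ j = u j := fun u v j => by
    simp [h01]
  have hrow₁ : ∀ (u v : Fin (n + r + 1 + 1) → ℝ) (j : Fin (n + r + 1 + 1)),
      (M.updateRow i₀ u).updateRow i₁ v i₁ j = v j := fun u v j => by
    simp
  have hbig : ∀ t, (Matrix.of fun i j : Fin (n + r + 1 + 1) =>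
      momentRow W (n + 1) (consParam t c) i j) = (M.updateRow i₀ P).updateRow i₁ (E t) := by
    intro t
    ext i j
    rw [Matrix.of_apply]
    rcases eq_or_ne i i₀ with rfl | h₀
    · rw [hrow₀]
      simp [momentRow, P, i₀]
    rcases eq_or_ne i i₁ with rfl | h₁
    · rw [hrow₁]
      simp [momentRow, E, i₁, consParam]
    rw [hrest _ _ _ _ h₀ h₁, hM_eq]
    have h₀' : (i : ℕ) ≠ n := fun h => h₀ (Fin.ext h)
    have h₁' : (i : ℕ) ≠ n + 1 := fun h => h₁ (Fin.ext h)
    rcases lt_or_ge (i : ℕ) n with h | h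
    · exact hrow_lt _ _ _ _ _ _ (by omega) h
    · refine hrow_ge _ _ _ _ _ _ _ (by omega) h ?_
      rw [consParam, consParam2, if_neg (by omega), if_neg (by omega), if_neg (by omega)]
      exact congrArg c (by omega)
  have htwo : M = (M.updateRow i₀ (E a)).updateRow i₁ (E b) := by
    ext i j
    rcases eq_or_ne i i₀ with rfl | h₀
    · rw [hrow₀, hM_eq]
      simp [momentRow, E, i₀, consParam2]
    rcases eq_or_ne i i₁ with rfl | h₁
    · rw [hrow₁, hM_eq]
      simp [momentRow, E, i₁, consParam2]
    rw [hrest _ _ _ _ h₀ h₁]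
  have hminor : ∀ (u : Fin (n + r + 1 + 1) → ℝ) (N : ℕ) (f : ℕ → ℝ), n ≤ N → N ≤ n + 1 →
      (∀ j : Fin (n + r + 1), momentRow W N f n j = u j.castSucc) →
      (∀ k, f (k + (n + 1 - N)) = c k) →
      ((M.updateRow i₀ u).updateRow i₁ e).det = (-1) ^ (n + 1 + (n + r + 1)) *
        (Matrix.of fun i j : Fin (n + r + 1) => momentRow W N f i j).det := by
    intro u N f hN hN' hu hf
    rw [det_updateRow_single_last]
    congr 2
    ext i j
    rw [Matrix.submatrix_apply, Matrix.of_apply]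
    rcases lt_or_ge (i : ℕ) (n + 1) with h | h
    · rw [Fin.succAbove_of_castSucc_lt _ _ (by simpa [Fin.lt_def, i₁] using h)]
      rcases eq_or_ne (i : ℕ) n with hi | hi
      · rw [show i.castSucc = i₀ from Fin.ext hi, Matrix.updateRow_self, hi, hu]
      · rw [Matrix.updateRow_ne fun h' => hi (Fin.ext_iff.1 h'), hM_eq]
        have hval : (i.castSucc : ℕ) = i := rfl
        exact hrow_lt _ _ _ _ _ _ (by omega) (by omega)
    · rw [Fin.succAbove_of_le_castSucc _ _ (by simpa [Fin.le_def, i₁] using h),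
        Matrix.updateRow_ne fun h' => by have := Fin.ext_iff.1 h'; simp [i₀] at this; omega, hM_eq]
      refine hrow_ge _ _ _ _ _ _ _ (by simp; omega) (by omega) ?_
      rw [consParam2, Fin.val_succ, if_neg (by omega), if_neg (by omega), ← hf]
      congr 1
      omega
  have hsmall : ∀ t, ((M.updateRow i₀ (E t)).updateRow i₁ e).det = (-1) ^ (n + 1 + (n + r + 1)) *
      (Matrix.of fun i j : Fin (n + r + 1) => momentRow W n (consParam t c) i j).det := fun t =>
    hminor _ _ _ le_rfl (Nat.le_succ n) (fun j => by simp [momentRow, E, consParam])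
      (fun k => by simp [consParam])
  have hsmall' : ((M.updateRow i₀ P).updateRow i₁ e).det = (-1) ^ (n + 1 + (n + r + 1)) *
      (Matrix.of fun i j : Fin (n + r + 1) => momentRow W (n + 1) c i j).det :=
    hminor _ _ _ (Nat.le_succ n) le_rfl (fun j => by simp [momentRow, P]) (fun k => by simp)
  have hplucker := det_updateRow_plucker M h01 P (E a) (E b) e
  rw [← hbig, ← hbig, hsmall, hsmall, hsmall', ← htwo] at hplucker
  rw [Zpart_eq_det hWmeas hWint (N := n + 1) (by omega),
    Zpart_eq_det hWmeas hWint (N := n) (by omega),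
    Zpart_eq_det hWmeas hWint (N := n + 1) (by omega),
    Zpart_eq_det hWmeas hWint (N := n) (by omega),
    Zpart_eq_det hWmeas hWint (N := n) (by omega),
    Zpart_eq_det hWmeas hWint (N := n + 1) (by omega)]
  rw [← hM, show 2 + r = 1 + (1 + r) by omega, consParam2_eq_consParam]
  simp only [prod_pairsBelow_consParam, prod_range_consParam _ _ _ fun y => y ^ n,
    prod_range_consParam _ _ _ fun y => y ^ (n + 1), prod_range_consParam _ _ _ fun y => y - a,
    mul_inv]
  have hs : (-1 : ℝ) ^ (n + 1 + (n + r + 1)) * (-1) ^ (n + 1 + (n + r + 1)) = 1 := by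
    rw [← mul_pow]
    simp
  have hpow : ∀ x : ℝ, x ≠ 0 → x * (x ^ (n + 1))⁻¹ = (x ^ n)⁻¹ := fun x hx => by
    field_simp
    ring
  have hdiff : (a - b) * (b - a)⁻¹ = -1 := by
    rw [← neg_sub b a, neg_mul, mul_inv_cancel₀ hab]
  have hpa := hpow a ha
  have hpb := hpow b hb
  generalize (-1 : ℝ) ^ (n + 1 + (n + r + 1)) = s at hs hplucker
  generalize (Matrix.of fun i j : Fin (n + r + 1 + 1) =>
    momentRow W (n + 1) (consParam a c) i j).det = Da at hplucker ⊢
  generalize (Matrix.of fun i j : Fin (n + r + 1 + 1) =>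
    momentRow W (n + 1) (consParam b c) i j).det = Db at hplucker ⊢
  generalize (Matrix.of fun i j : Fin (n + r + 1) =>
    momentRow W n (consParam a c) i j).det = da at hplucker ⊢
  generalize (Matrix.of fun i j : Fin (n + r + 1) =>
    momentRow W n (consParam b c) i j).det = db at hplucker ⊢
  generalize (Matrix.of fun i j : Fin (n + r + 1) =>
    momentRow W (n + 1) c i j).det = q at hplucker ⊢
  have hdet : Da * db - Db * da = -(M.det * q) := by
    linear_combination s * hplucker - (Da * db - Db * da + M.det * q) * hs
  generalize M.det = D at hdet ⊢
  generalize (a ^ (n + 1))⁻¹ = pa' at hpa ⊢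
  generalize (b ^ (n + 1))⁻¹ = pb' at hpb ⊢
  generalize (a ^ n)⁻¹ = pa at hpa ⊢
  generalize (b ^ n)⁻¹ = pb at hpb ⊢
  generalize (b - a)⁻¹ = w at hdiff ⊢
  generalize (∏ k ∈ Finset.range r, (c k - a))⁻¹ = va
  generalize (∏ k ∈ Finset.range r, (c k - b))⁻¹ = vb
  generalize (∏ p ∈ pairsBelow r, (c p.2 - c p.1))⁻¹ = v
  generalize (∏ k ∈ Finset.range r, c k ^ (n + 1))⁻¹ = pc'
  generalize (∏ k ∈ Finset.range r, c k ^ n)⁻¹ = pc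
  generalize (∏ i ∈ Finset.range (n + 1), (i.factorial : ℝ))⁻¹ = F'
  generalize (∏ i ∈ Finset.range n, (i.factorial : ℝ))⁻¹ = F
  generalize ((n + r + 1 + 1).factorial : ℝ) = G'
  generalize ((n + r + 1).factorial : ℝ) = G
  linear_combination (F * F' * va * vb * v ^ 2 * pc * pc' * G * G') *
    (Da * db * pb * hpa - Db * da * pa * hpb + pa * pb * hdet - pa * pb * D * q * hdiff)
end

section
/- Let l ≥ 1 and a ∈ ℝ. Then ∫_{ℝ^l} det A(λ) · det[ p_{q−1}(λ_p) ]_{p,q=1}^{l} · ∏_{i=1}^{l} W(λ_i) dλ_1⋯dλ_l = l! · Γ_{l−1}(a), where A(λ) is the l×l matrix with entries A(λ)_{p,q} = p_{q−1}(λ_p) for 1 ≤ q ≤ l−1 and A(λ)_{p,l} = exp(a λ_p), and det[ p_{q−1}(λ_p) ]_{p,q=1}^{l} is the determinant of the l×l matrix whose (p,q) entry is p_{q−1}(λ_p). -/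
open MeasureTheory
open scoped BigOperators

/-- **Andréief's identity**: the integral of a product of two determinants of functions is
`n!` times the determinant of the matrix of pairings. -/
theorem integral_det_mul_det_mul_prod_s9 {ι α : Type*} [Fintype ι] [DecidableEq ι]
    [MeasureSpace α] [SigmaFinite (volume : Measure α)] (f g : ι → α → ℝ) (w : α → ℝ)
    (h : ∀ i j, Integrable fun x => f i x * g j x * w x) :
    ∫ x : ι → α, (Matrix.of fun p q => f q (x p)).det * (Matrix.of fun p q => g q (x p)).det *
        ∏ i, w (x i) =
      (Fintype.card ι).factorial * (Matrix.of fun i j => ∫ x, f i x * g j x * w x).det := by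
  have expand : ∀ x : ι → α,
      (Matrix.of fun p q => f q (x p)).det * (Matrix.of fun p q => g q (x p)).det *
        ∏ i, w (x i) =
      ∑ σ : Equiv.Perm ι, ∑ τ : Equiv.Perm ι,
        ((σ.sign : ℤ) : ℝ) * ((τ.sign : ℤ) : ℝ) *
          ∏ i, (f (σ i) (x i) * g (τ i) (x i) * w (x i)) := by
    intro x
    rw [← Matrix.det_transpose, ← Matrix.det_transpose (Matrix.of fun p q => g q (x p)),
      Matrix.det_apply', Matrix.det_apply', Finset.sum_mul_sum, Finset.sum_mul]
    refine Finset.sum_congr rfl fun σ _ => ?_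
    rw [Finset.sum_mul]
    refine Finset.sum_congr rfl fun τ _ => ?_
    simp only [Matrix.transpose_apply, Matrix.of_apply, Finset.prod_mul_distrib]
    ring
  have hint : ∀ σ τ : Equiv.Perm ι, Integrable fun x : ι → α =>
      ((σ.sign : ℤ) : ℝ) * ((τ.sign : ℤ) : ℝ) *
          ∏ i, (f (σ i) (x i) * g (τ i) (x i) * w (x i)) := fun σ τ =>
    (Integrable.fintype_prod_dep
      (f := fun i y => f (σ i) y * g (τ i) y * w y) fun i => h (σ i) (τ i)).const_mul _
  simp_rw [expand]
  rw [integral_finsetSum _ fun σ _ => integrable_finsetSum _ fun τ _ => hint σ τ]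
  set M := Matrix.of fun i j => ∫ x, f i x * g j x * w x
  have inner_sum : ∀ σ : Equiv.Perm ι, ∫ x : ι → α, ∑ τ : Equiv.Perm ι,
      ((σ.sign : ℤ) : ℝ) * ((τ.sign : ℤ) : ℝ) *
          ∏ i, (f (σ i) (x i) * g (τ i) (x i) * w (x i)) = M.det := by
    intro σ
    rw [integral_finsetSum _ fun τ _ => hint σ τ]
    have key : ((σ.sign : ℤ) : ℝ) * (M.submatrix σ id).det = M.det := by
      rw [Matrix.det_permute, ← mul_assoc, ← Int.cast_mul, Int.units_coe_mul_self,
        Int.cast_one, one_mul]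
    rw [← key, ← Matrix.det_transpose, Matrix.det_apply', Finset.mul_sum]
    refine Finset.sum_congr rfl fun τ _ => ?_
    rw [integral_const_mul, integral_fintype_prod_volume_eq_prod
      (fun i y => f (σ i) y * g (τ i) y * w y), mul_assoc]
    rfl
  simp_rw [inner_sum]
  rw [Finset.sum_const, Finset.card_univ, Fintype.card_perm, nsmul_eq_mul]

theorem integrable_eval_mul_exp_mul {W : ℝ → ℝ} (hWmeas : Measurable W)
    (hWint : ∀ (n : ℕ) (b : ℝ), Integrable (fun x => |x| ^ n * Real.exp (b * x) * W x))
    (Q : Polynomial ℝ) (b : ℝ) :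
    Integrable fun x => Q.eval x * Real.exp (b * x) * W x := by
  have hmono : ∀ n : ℕ, Integrable fun x => x ^ n * Real.exp (b * x) * W x := fun n =>
    (hWint n b).mono (by fun_prop) (.of_forall fun x => by simp)
  simp_rw [Polynomial.eval_eq_sum_range, Finset.sum_mul, mul_assoc]
  refine integrable_finsetSum _ fun n _ => ?_
  simpa only [mul_assoc] using (hmono n).const_mul (Q.coeff n)

/-- Row-reduced partition-function integral of a rank-one external source model:
`∫_{ℝ^l} det A(λ) · det[p_{q−1}(λ_p)] ∏ W(λ_i) dλ = l! · Γ_{l−1}(a)`,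
where `A(λ)` has columns `p_0(λ_p), …, p_{l−2}(λ_p), e^{aλ_p}`, the `p_j` are the
orthonormal polynomials of the weight `W`, and `Γ_j(a) = ∫ p_j(x) e^{ax} W(x) dx`. -/
theorem integral_det_orthonormal_eq_factorial_mul_Gamma
    (W : ℝ → ℝ) (hWmeas : Measurable W) (hWnonneg : ∀ x, 0 ≤ W x)
    (hWsupp : (Function.support W).Infinite)
    (hWint : ∀ (n : ℕ) (b : ℝ), Integrable (fun x => |x| ^ n * Real.exp (b * x) * W x))
    (P : ℕ → Polynomial ℝ)
    (hPdeg : ∀ j, (P j).natDegree = j)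
    (hPlead : ∀ j, 0 < (P j).leadingCoeff)
    (hPorth : ∀ j k, ∫ x : ℝ, (P j).eval x * (P k).eval x * W x = if j = k then 1 else 0)
    (l : ℕ) (hl : 1 ≤ l) (a : ℝ) :
    ∫ lam : Fin l → ℝ,
        (Matrix.of fun p q : Fin l =>
            if (q : ℕ) < l - 1 then (P (q : ℕ)).eval (lam p) else Real.exp (a * lam p)).det *
          (Matrix.of fun p q : Fin l => (P (q : ℕ)).eval (lam p)).det *
          ∏ i : Fin l, W (lam i) =
      (l.factorial : ℝ) * ∫ x : ℝ, (P (l - 1)).eval x * Real.exp (a * x) * W x := by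
  let f : Fin l → ℝ → ℝ := fun q x =>
    if (q : ℕ) < l - 1 then (P q).eval x else Real.exp (a * x)
  let g : Fin l → ℝ → ℝ := fun q x => (P q).eval x
  have hfg : ∀ i j, Integrable fun x => f i x * g j x * W x := by
    intro i j
    by_cases hi : (i : ℕ) < l - 1
    · simpa [f, g, hi] using integrable_eval_mul_exp_mul hWmeas hWint (P i * P j) 0
    · simpa [f, g, hi, mul_comm, mul_left_comm] using
        integrable_eval_mul_exp_mul hWmeas hWint (P j) a
  refine (integral_det_mul_det_mul_prod_s9 f g W hfg).trans ?_
  have hrow : ∀ i j : Fin l, (i : ℕ) < l - 1 →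
      ∫ x, f i x * g j x * W x = if i = j then 1 else 0 := by
    intro i j hi
    simp only [f, g, hi, if_true, hPorth, Fin.ext_iff]
  rw [Fintype.card_fin, Matrix.det_of_isLowerTriangular]
  · congr 1
    rw [Finset.prod_eq_single (⟨l - 1, by omega⟩ : Fin l)]
    · simp [f, g, mul_comm]
    · intro i _ hi
      have hi' : (i : ℕ) < l - 1 := by
        have := i.isLt
        have : (i : ℕ) ≠ l - 1 := fun h => hi (Fin.ext h)
        omega
      simp [hrow i i hi']
    · simp
  · intro i j hij
    have hij' : i < j := hij
    have := j.isLt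
    rw [Matrix.of_apply, hrow i j (by rw [Fin.lt_def] at hij'; omega), if_neg hij'.ne]
end
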